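/- For every k ≥ 1, with n = 2^k, every cancellation-free linear circuit computing the n×n Sierpinski gasket matrix S_k has size at least (1/2)·n·log₂ n = k·2^{k−1}. -/

import Mathlib

/-- A linear circuit over `F_2` with `n` inputs, given as a straight-line program.
Vertices `0, …, n-1` are the inputs `x_1, …, x_n`; vertex `n + g` is gate `g`.
Each gate has in-degree two: its two children `left g` and `right g` are earlier
vertices, and the gate computes the XOR of its children. -/
structure LinCircuit (n : ℕ) where
  gates : ℕ
  left : Fin gates → ℕ
  right : Fin gates → ℕ
  left_lt : ∀ g, left g < n + g.val
  right_lt : ∀ g, right g < n + g.val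

namespace LinCircuit

variable {n : ℕ}

/-- The value vector `κ(v) ∈ F_2^n` of the vertex `v`: for an input `x_i` it is
the `i`-th standard unit vector, and for a gate it is the sum of the value
vectors of its two children. -/
def val (C : LinCircuit n) (v : ℕ) : Fin n → ZMod 2 :=
  if _h1 : v < n then fun j => if (j : ℕ) = v then 1 else 0
  else if h2 : v - n < C.gates then
    C.val (C.left ⟨v - n, h2⟩) + C.val (C.right ⟨v - n, h2⟩)
  else 0
termination_by v
decreasing_by
  · have := C.left_lt ⟨v - n, h2⟩; simp only [Fin.val_mk] at this; omega
  · have := C.right_lt ⟨v - n, h2⟩; simp only [Fin.val_mk] at this; omega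

/-- `C` computes the `m × n` matrix `A` if there are `m` designated output
vertices whose value vectors are exactly the rows of `A`. -/
def Computes {m : ℕ} (C : LinCircuit n) (A : Matrix (Fin m) (Fin n) (ZMod 2)) : Prop :=
  ∃ out : Fin m → ℕ, (∀ o, out o < n + C.gates) ∧ ∀ o j, C.val (out o) j = A o j

/-- `Edge C w u`: there is a wire from vertex `w` to vertex `u`,
i.e. `u` is a gate having `w` as one of its two children. -/
def Edge (C : LinCircuit n) (w u : ℕ) : Prop :=
  ∃ g : Fin C.gates, u = n + g.val ∧ (C.left g = w ∨ C.right g = w)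

/-- A circuit is cancellation-free if along every directed path the value
vectors only grow in the coordinatewise partial order. -/
def CancellationFree (C : LinCircuit n) : Prop :=
  ∀ w u : ℕ, Relation.TransGen C.Edge w u → ∀ i : Fin n, C.val w i = 1 → C.val u i = 1

end LinCircuit

/-- The Sierpinski gasket matrix `S_k`, defined recursively by `S_0 = (1)` and
`S_{k+1} = [[S_k, 0], [S_k, S_k]]` as a block matrix. -/
def sierpinski : (k : ℕ) → Matrix (Fin (2 ^ k)) (Fin (2 ^ k)) (ZMod 2)
  | 0 => Matrix.of fun _ _ => 1
  | (k + 1) => Matrix.of fun i j =>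
      have he : 2 ^ (k + 1) = 2 ^ k + 2 ^ k := by rw [pow_succ]; ring
      have hi2 : (i : ℕ) < 2 ^ k + 2 ^ k := by have := i.isLt; omega
      have hj2 : (j : ℕ) < 2 ^ k + 2 ^ k := by have := j.isLt; omega
      if hi : (i : ℕ) < 2 ^ k then
        if hj : (j : ℕ) < 2 ^ k then sierpinski k ⟨i, hi⟩ ⟨j, hj⟩ else 0
      else
        if hj : (j : ℕ) < 2 ^ k then sierpinski k ⟨(i : ℕ) - 2 ^ k, by omega⟩ ⟨j, hj⟩
        else sierpinski k ⟨(i : ℕ) - 2 ^ k, by omega⟩ ⟨(j : ℕ) - 2 ^ k, by omega⟩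

def SGood (F : Finset (Finset ℕ)) : Prop :=
  ∀ s ∈ F, 2 ≤ s.card → ∃ a b : Finset ℕ, a ∈ F ∧ b ∈ F ∧ a.Nonempty ∧ b.Nonempty ∧
    Disjoint a b ∧ a ∪ b = s

def srow : ℕ → ℕ → ℕ → Finset ℕ
  | 0, o, _ => {o}
  | (k + 1), o, i => if i < 2 ^ k then srow k o i
      else srow k o (i - 2 ^ k) ∪ srow k (o + 2 ^ k) (i - 2 ^ k)

theorem srow_bd (k o i j : ℕ) (h : j ∈ srow k o i) : o ≤ j ∧ j < o + 2 ^ k := by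
  induction k generalizing o i with
  | zero => simp [srow] at h; simp; omega
  | succ k ih =>
    have he : 2 ^ (k + 1) = 2 ^ k + 2 ^ k := by rw [pow_succ]; ring
    rw [srow] at h
    split_ifs at h with hi
    · have := ih _ _ h; omega
    · rcases Finset.mem_union.1 h with h | h
      · have := ih _ _ h; omega
      · have := ih _ _ h; omega

def sind (s : Finset ℕ) : ℕ → ℚ := fun j => if j ∈ s then 1 else 0

theorem sind_union {a b : Finset ℕ} (h : Disjoint a b) : sind (a ∪ b) = sind a + sind b := by
  funext j
  have : j ∈ a → j ∉ b := fun h1 => Finset.disjoint_left.1 h h1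
  by_cases ha : j ∈ a <;> by_cases hb : j ∈ b <;> simp_all [sind]

theorem srow_disj (k o i i' : ℕ) : Disjoint (srow k o i) (srow k (o + 2 ^ k) i') := by
  rw [Finset.disjoint_left]
  intro j h1 h2
  have := srow_bd _ _ _ _ h1
  have := srow_bd _ _ _ _ h2
  omega

theorem srow_span (k o : ℕ) (W : Submodule ℚ (ℕ → ℚ))
    (h : ∀ i < 2 ^ k, sind (srow k o i) ∈ W) :
    ∀ i < 2 ^ k, (Pi.single (o + i) 1 : ℕ → ℚ) ∈ W := by
  induction k generalizing o with
  | zero =>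
    intro i hi
    have hi0 : i = 0 := by simpa using hi
    subst hi0
    convert h 0 (by simp) using 1
    funext j
    simp [sind, srow, Pi.single_apply]
  | succ k ih =>
    have he : 2 ^ (k + 1) = 2 ^ k + 2 ^ k := by rw [pow_succ]; ring
    have h1 : ∀ i < 2 ^ k, sind (srow k o i) ∈ W := by
      intro i hi
      have := h i (by omega)
      rwa [srow, if_pos hi] at this
    have h2 : ∀ i < 2 ^ k, sind (srow k (o + 2 ^ k) i) ∈ W := by
      intro i hi
      have := h (2 ^ k + i) (by omega)
      rw [srow, if_neg (by omega), Nat.add_sub_cancel_left, sind_union (srow_disj _ _ _ _)] at this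
      exact (Submodule.add_mem_iff_right W (h1 i hi)).1 this
    intro i hi
    by_cases hik : i < 2 ^ k
    · exact ih o h1 i hik
    · have := ih _ h2 (i - 2 ^ k) (by omega)
      rwa [show o + 2 ^ k + (i - 2 ^ k) = o + i by omega] at this

theorem srow_rank (k o : ℕ) (w : Finset (ℕ → ℚ))
    (h : ∀ i < 2 ^ k, sind (srow k o i) ∈ Submodule.span ℚ (w : Set (ℕ → ℚ))) :
    2 ^ k ≤ w.card := by
  have hs := srow_span k o _ h
  have hli : LinearIndependent ℚ (fun i : Fin (2 ^ k) => (Pi.single (o + i.val) 1 : ℕ → ℚ)) := by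
    have := (Pi.linearIndependent_single_one ℕ ℚ).comp (fun i : Fin (2 ^ k) => o + i.val)
      (fun a b hab => Fin.ext (by simpa using hab))
    exact this
  have := linearIndependent_le_span_aux' _ hli (w : Set (ℕ → ℚ)) (by
    rintro _ ⟨i, rfl⟩
    exact hs i i.isLt)
  simpa using this

theorem sgood_main (k o : ℕ) (F : Finset (Finset ℕ)) (hF : SGood F)
    (hr : ∀ i < 2 ^ k, srow k o i ∈ F) :
    k * 2 ^ k ≤ 2 * (F.filter (fun s => 2 ≤ s.card)).card := by
  classical
  induction k generalizing o F with
  | zero => simp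
  | succ k ih =>
    have he : 2 ^ (k + 1) = 2 ^ k + 2 ^ k := by rw [pow_succ]; ring
    set m := o + 2 ^ k with hm
    let p : Finset ℕ → Finset ℕ := fun s => s.filter (· < m)
    let q : Finset ℕ → Finset ℕ := fun s => s.filter (m ≤ ·)
    have hF' := hF
    unfold SGood at hF'
    choose! l r hl hrr hln hrn hd hu using hF'
    have hlc : ∀ s ∈ F, 2 ≤ s.card → (l s).card < s.card ∧ (r s).card < s.card := by
      intro s hs h2
      have h := Finset.card_union_of_disjoint (hd s hs h2)
      rw [hu s hs h2] at h
      have := Finset.card_pos.2 (hln s hs h2)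
      have := Finset.card_pos.2 (hrn s hs h2)
      omega
    have hqu : ∀ s ∈ F, 2 ≤ s.card → q s = q (l s) ∪ q (r s) := by
      intro s hs h2
      conv_lhs => rw [← hu s hs h2]
      exact Finset.filter_union _ _ _
    have hpu : ∀ s ∈ F, 2 ≤ s.card → p s = p (l s) ∪ p (r s) := by
      intro s hs h2
      conv_lhs => rw [← hu s hs h2]
      exact Finset.filter_union _ _ _
    have hdp : ∀ s ∈ F, 2 ≤ s.card → Disjoint (p (l s)) (p (r s)) := fun s hs h2 =>
      Finset.disjoint_filter_filter (hd s hs h2)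
    have hdq : ∀ s ∈ F, 2 ≤ s.card → Disjoint (q (l s)) (q (r s)) := fun s hs h2 =>
      Finset.disjoint_filter_filter (hd s hs h2)
    let G := F.filter (fun s => 2 ≤ s.card)
    let A := G.filter (fun s => q s = ∅)
    let B := G.filter (fun s => q (l s) ≠ ∅ ∧ q (r s) ≠ ∅)
    let D := G.filter (fun s => q s ≠ ∅ ∧ (q (l s) = ∅ ∨ q (r s) = ∅))
    have hcard : A.card + B.card + D.card ≤ G.card := by
      have d1 : Disjoint A B := by
        rw [Finset.disjoint_left]
        intro s h1 h2
        simp only [A, B, G, Finset.mem_filter] at h1 h2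
        have := hqu s h1.1.1 h1.1.2
        rw [h1.2] at this
        have := (Finset.union_eq_empty.1 this.symm).1
        exact h2.2.1 this
      have d2 : Disjoint (A ∪ B) D := by
        rw [Finset.disjoint_left]
        intro s h1 h2
        simp only [A, B, D, G, Finset.mem_filter, Finset.mem_union] at h1 h2
        tauto
      rw [← Finset.card_union_of_disjoint d1, ← Finset.card_union_of_disjoint d2]
      apply Finset.card_le_card
      exact Finset.union_subset (Finset.union_subset (Finset.filter_subset _ _)
        (Finset.filter_subset _ _)) (Finset.filter_subset _ _)
    have hrow1 : ∀ i < 2 ^ k, srow k o i ∈ F := by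
      intro i hi
      have := hr i (by omega)
      rwa [srow, if_pos hi] at this
    have hrow2 : ∀ i < 2 ^ k, srow k o i ∪ srow k m i ∈ F := by
      intro i hi
      have := hr (2 ^ k + i) (by omega)
      rwa [srow, if_neg (by omega), Nat.add_sub_cancel_left] at this
    have hq1 : ∀ i, q (srow k o i) = ∅ := by
      intro i
      refine Finset.filter_eq_empty_iff.2 fun j hj => ?_
      have := srow_bd _ _ _ _ hj
      omega
    have hq2 : ∀ i, q (srow k m i) = srow k m i := by
      intro i
      refine Finset.filter_eq_self.2 fun j hj => ?_
      have := srow_bd _ _ _ _ hj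
      omega
    have hp1 : ∀ i, p (srow k o i) = srow k o i := by
      intro i
      refine Finset.filter_eq_self.2 fun j hj => ?_
      have := srow_bd _ _ _ _ hj
      omega
    have hp2 : ∀ i, p (srow k m i) = ∅ := by
      intro i
      refine Finset.filter_eq_empty_iff.2 fun j hj => ?_
      have := srow_bd _ _ _ _ hj
      omega
    have hA : k * 2 ^ k ≤ 2 * A.card := by
      have := ih o (F.filter (fun s => q s = ∅)) (by
        intro s hs h2
        obtain ⟨hs, hqs⟩ := Finset.mem_filter.1 hs
        have h := hqu s hs h2
        rw [hqs] at h
        have h := Finset.union_eq_empty.1 h.symm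
        exact ⟨l s, r s, Finset.mem_filter.2 ⟨hl s hs h2, h.1⟩,
          Finset.mem_filter.2 ⟨hrr s hs h2, h.2⟩, hln s hs h2, hrn s hs h2, hd s hs h2,
          hu s hs h2⟩) (fun i hi => Finset.mem_filter.2 ⟨hrow1 i hi, hq1 i⟩)
      rwa [Finset.filter_comm] at this
    -- minimal representatives
    have hmin : ∀ t ∈ F.image q, 2 ≤ t.card → ∃ s ∈ B, q s = t := by
      intro t ht h2
      obtain ⟨s0, hs0, hq0⟩ := Finset.mem_image.1 ht
      obtain ⟨s, hs, hsm⟩ := Finset.exists_min_image (F.filter (fun s => q s = t)) Finset.card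
        ⟨s0, Finset.mem_filter.2 ⟨hs0, hq0⟩⟩
      obtain ⟨hsF, hst⟩ := Finset.mem_filter.1 hs
      have hs2 : 2 ≤ s.card := by
        have : (q s).card ≤ s.card := Finset.card_filter_le _ _
        rw [hst] at this
        omega
      have hlt := hlc s hsF hs2
      have hqq := hqu s hsF hs2
      refine ⟨s, Finset.mem_filter.2 ⟨Finset.mem_filter.2 ⟨hsF, hs2⟩, ?_, ?_⟩, hst⟩
      · intro h
        rw [h, Finset.empty_union, hst] at hqq
        have := hsm (r s) (Finset.mem_filter.2 ⟨hrr s hsF hs2, hqq.symm⟩)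
        omega
      · intro h
        rw [h, Finset.union_empty, hst] at hqq
        have := hsm (l s) (Finset.mem_filter.2 ⟨hl s hsF hs2, hqq.symm⟩)
        omega
    have hB : k * 2 ^ k ≤ 2 * B.card := by
      have h1 := ih m (F.image q) (by
        intro t ht h2
        obtain ⟨s, hs, hst⟩ := hmin t ht h2
        simp only [B, G, Finset.mem_filter] at hs
        obtain ⟨⟨hsF, hs2⟩, ha, hb⟩ := hs
        exact ⟨q (l s), q (r s), Finset.mem_image_of_mem _ (hl s hsF hs2),
          Finset.mem_image_of_mem _ (hrr s hsF hs2), Finset.nonempty_iff_ne_empty.2 ha,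
          Finset.nonempty_iff_ne_empty.2 hb, hdq s hsF hs2, by rw [← hqu s hsF hs2, hst]⟩)
        (by
          intro i hi
          refine Finset.mem_image.2 ⟨_, hrow2 i hi, ?_⟩
          have : q (srow k o i ∪ srow k m i) = q (srow k o i) ∪ q (srow k m i) :=
            Finset.filter_union _ _ _
          rw [this, hq1, hq2, Finset.empty_union])
      have h2 : ((F.image q).filter (fun s => 2 ≤ s.card)).card ≤ B.card := by
        refine le_trans (Finset.card_le_card ?_) (Finset.card_image_le (s := B) (f := q))
        intro t ht
        obtain ⟨ht, h2⟩ := Finset.mem_filter.1 ht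
        obtain ⟨s, hs, hst⟩ := hmin t ht h2
        exact Finset.mem_image.2 ⟨s, hs, hst⟩
      omega
    let c : Finset ℕ → Finset ℕ := fun s => if q (l s) = ∅ then l s else r s
    let w : Finset (ℕ → ℚ) := D.image (fun s => sind (p (c s)))
    have hspan : ∀ N, ∀ s ∈ F, s.card = N → q s ≠ ∅ →
        sind (p s) ∈ Submodule.span ℚ (w : Set (ℕ → ℚ)) := by
      intro N
      induction N using Nat.strong_induction_on with
      | _ N ihN =>
      intro s hs hN hqs
      by_cases h2 : 2 ≤ s.card
      · rw [hpu s hs h2, sind_union (hdp s hs h2)]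
        have hlt := hlc s hs h2
        have hqq := hqu s hs h2
        by_cases hql : q (l s) = ∅
        · refine Submodule.add_mem _ (Submodule.subset_span ?_)
            (ihN _ (by omega) (r s) (hrr s hs h2) rfl ?_)
          · refine Finset.mem_coe.2 (Finset.mem_image.2 ⟨s, ?_, ?_⟩)
            · exact Finset.mem_filter.2 ⟨Finset.mem_filter.2 ⟨hs, h2⟩, hqs, Or.inl hql⟩
            · simp only [c, if_pos hql]
          · rwa [hqq, hql, Finset.empty_union] at hqs
        · refine Submodule.add_mem _ (ihN _ (by omega) (l s) (hl s hs h2) rfl hql) ?_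
          by_cases hqr : q (r s) = ∅
          · refine Submodule.subset_span (Finset.mem_coe.2 (Finset.mem_image.2 ⟨s, ?_, ?_⟩))
            · exact Finset.mem_filter.2 ⟨Finset.mem_filter.2 ⟨hs, h2⟩, hqs, Or.inr hqr⟩
            · simp only [c, if_neg hql]
          · exact ihN _ (by omega) (r s) (hrr s hs h2) rfl hqr
      · have hps : p s = ∅ := by
          obtain ⟨x, hx⟩ := Finset.nonempty_iff_ne_empty.2 hqs
          obtain ⟨hx, hxm⟩ := Finset.mem_filter.1 hx
          refine Finset.filter_eq_empty_iff.2 fun j hj => ?_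
          have := Finset.card_le_one.1 (by omega : s.card ≤ 1) j hj x hx
          omega
        rw [hps]
        have : sind ∅ = 0 := by funext j; simp [sind]
        rw [this]
        exact Submodule.zero_mem _
    have hD : 2 ^ k ≤ D.card := by
      refine le_trans (srow_rank k o w ?_) Finset.card_image_le
      intro i hi
      have h := hspan _ _ (hrow2 i hi) rfl
      have e1 : q (srow k o i ∪ srow k m i) = q (srow k o i) ∪ q (srow k m i) :=
            Finset.filter_union _ _ _
      have e2 : p (srow k o i ∪ srow k m i) = p (srow k o i) ∪ p (srow k m i) :=
            Finset.filter_union _ _ _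
      rw [e1, e2, hp1, hp2, hq1, hq2, Finset.union_empty, Finset.empty_union] at h
      apply h
      clear h e1 e2
      rw [← Finset.nonempty_iff_ne_empty]
      clear_value m
      clear * -
      induction k generalizing m i with
      | zero => simp [srow]
      | succ k ih =>
        rw [srow]
        split_ifs
        · exact ih _ _
        · exact (ih _ _).mono Finset.subset_union_left
    change (k + 1) * 2 ^ (k + 1) ≤ 2 * G.card
    rw [he]
    nlinarith

theorem srow_iff (k o : ℕ) (i j : Fin (2 ^ k)) :
    sierpinski k i j = 1 ↔ o + j.val ∈ srow k o i.val := by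
  induction k generalizing o with
  | zero =>
    have : j.val = 0 := by have := j.isLt; simpa using this
    simp [sierpinski, srow, this]
  | succ k ih =>
    have he : 2 ^ (k + 1) = 2 ^ k + 2 ^ k := by rw [pow_succ]; ring
    have hi2 := i.isLt
    have hj2 := j.isLt
    rw [srow]
    simp only [sierpinski, Matrix.of_apply]
    have hn1 : ∀ a, ¬ j.val < 2 ^ k → o + j.val ∉ srow k o a := by
      intro a h h'
      have := srow_bd _ _ _ _ h'
      omega
    have hn2 : ∀ a, j.val < 2 ^ k → o + j.val ∉ srow k (o + 2 ^ k) a := by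
      intro a h h'
      have := srow_bd _ _ _ _ h'
      omega
    split_ifs with hi hj hj
    · exact ih o _ _
    · simp [hn1 _ hj]
    · rw [Finset.mem_union, ih o]
      simp [hn2 _ hj]
    · rw [Finset.mem_union, ih (o + 2 ^ k)]
      rw [show o + 2 ^ k + (j.val - 2 ^ k) = o + j.val by omega]
      simp [hn1 _ hj]

namespace LinCircuit

theorem val_input {n : ℕ} (C : LinCircuit n) (v : ℕ) (h : v < n) (j : Fin n) :
    C.val v j = if (j : ℕ) = v then 1 else 0 := by
  rw [val, dif_pos h]

theorem val_gate {n : ℕ} (C : LinCircuit n) (g : Fin C.gates) :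
    C.val (n + g.val) = C.val (C.left g) + C.val (C.right g) := by
  rw [val, dif_neg (by omega)]
  simp

def vset {n : ℕ} (C : LinCircuit n) (v : ℕ) : Finset ℕ :=
  (Finset.univ.filter (fun j : Fin n => C.val v j = 1)).image Fin.val

theorem mem_vset {n : ℕ} (C : LinCircuit n) (v x : ℕ) :
    x ∈ C.vset v ↔ ∃ h : x < n, C.val v ⟨x, h⟩ = 1 := by
  simp only [vset, Finset.mem_image, Finset.mem_filter, Finset.mem_univ, true_and]
  constructor
  · rintro ⟨a, ha, rfl⟩; exact ⟨a.isLt, ha⟩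
  · rintro ⟨h, h'⟩; exact ⟨_, h', rfl⟩

theorem vset_input {n : ℕ} (C : LinCircuit n) (v : ℕ) (h : v < n) : C.vset v = {v} := by
  ext x
  rw [mem_vset, Finset.mem_singleton]
  constructor
  · rintro ⟨hx, h1⟩
    rw [val_input _ _ h] at h1
    by_contra hne
    simp [hne] at h1
  · rintro rfl
    exact ⟨h, by simp [val_input _ _ h]⟩

theorem vset_left {n : ℕ} (C : LinCircuit n) (hcf : C.CancellationFree) (g : Fin C.gates) :
    C.vset (C.left g) ⊆ C.vset (n + g.val) := by
  intro x hx
  rw [mem_vset] at *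
  obtain ⟨h, h1⟩ := hx
  exact ⟨h, hcf _ _ (Relation.TransGen.single ⟨g, rfl, Or.inl rfl⟩) _ h1⟩

theorem vset_right {n : ℕ} (C : LinCircuit n) (hcf : C.CancellationFree) (g : Fin C.gates) :
    C.vset (C.right g) ⊆ C.vset (n + g.val) := by
  intro x hx
  rw [mem_vset] at *
  obtain ⟨h, h1⟩ := hx
  exact ⟨h, hcf _ _ (Relation.TransGen.single ⟨g, rfl, Or.inr rfl⟩) _ h1⟩

theorem vset_disj {n : ℕ} (C : LinCircuit n) (hcf : C.CancellationFree) (g : Fin C.gates) :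
    Disjoint (C.vset (C.left g)) (C.vset (C.right g)) := by
  rw [Finset.disjoint_left]
  intro x h1 h2
  have h3 := C.vset_left hcf g h1
  rw [mem_vset] at *
  obtain ⟨h, h1⟩ := h1
  obtain ⟨_, h2⟩ := h2
  obtain ⟨_, h3⟩ := h3
  rw [val_gate, Pi.add_apply, h1, h2] at h3
  exact absurd h3 (by decide)

theorem vset_union {n : ℕ} (C : LinCircuit n) (hcf : C.CancellationFree) (g : Fin C.gates) :
    C.vset (C.left g) ∪ C.vset (C.right g) = C.vset (n + g.val) := by
  apply Finset.Subset.antisymm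
  · exact Finset.union_subset (C.vset_left hcf g) (C.vset_right hcf g)
  · intro x hx
    rw [Finset.mem_union, mem_vset, mem_vset]
    rw [mem_vset] at hx
    obtain ⟨h, h1⟩ := hx
    rw [val_gate, Pi.add_apply] at h1
    generalize hA : C.val (C.left g) ⟨x, h⟩ = a at *
    generalize hB : C.val (C.right g) ⟨x, h⟩ = b at *
    have key : ∀ a b : ZMod 2, a + b = 1 → a = 1 ∨ b = 1 := by decide
    rcases key a b h1 with h' | h'
    · exact Or.inl ⟨h, hA.trans h'⟩
    · exact Or.inr ⟨h, hB.trans h'⟩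

theorem vset_nonempty {n : ℕ} (C : LinCircuit n) (hcf : C.CancellationFree) (v : ℕ)
    (hv : v < n + C.gates) : (C.vset v).Nonempty := by
  induction v using Nat.strong_induction_on with
  | _ v ih =>
    by_cases h : v < n
    · rw [vset_input _ _ h]; simp
    · have hl := C.left_lt ⟨v - n, by omega⟩
      have hs := C.vset_left hcf ⟨v - n, by omega⟩
      simp only at hl hs
      rw [show n + (v - n) = v by omega] at hl hs
      exact (ih _ hl (by omega)).mono hs

end LinCircuit

/-- For every `k ≥ 1`, with `n = 2^k`, every
cancellation-free linear circuit computing the `n × n` Sierpinski gasket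
matrix `S_k` has size at least `(1/2) · n · log₂ n = k · 2^(k−1)`. -/
theorem sierpinski_cancellationFree_lower_bound (k : ℕ) (hk : 1 ≤ k)
    (C : LinCircuit (2 ^ k)) (hcf : C.CancellationFree)
    (hS : C.Computes (sierpinski k)) :
    k * 2 ^ (k - 1) ≤ C.gates := by
  classical
  obtain ⟨out, ho, hv⟩ := hS
  let F := (Finset.range (2 ^ k + C.gates)).image C.vset
  have hcase : ∀ s ∈ F, 2 ≤ s.card → ∃ g : Fin C.gates, C.vset (2 ^ k + g.val) = s := by
    intro s hs h2
    obtain ⟨v, hvr, rfl⟩ := Finset.mem_image.1 hs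
    rw [Finset.mem_range] at hvr
    by_cases h : v < 2 ^ k
    · rw [C.vset_input _ h] at h2; simp at h2
    · exact ⟨⟨v - 2 ^ k, by omega⟩, by simp only; congr 1; omega⟩
  have hmem : ∀ v, v < 2 ^ k + C.gates → C.vset v ∈ F := fun v h =>
    Finset.mem_image_of_mem _ (Finset.mem_range.2 h)
  have hmain := sgood_main k 0 F (by
    intro s hs h2
    obtain ⟨g, rfl⟩ := hcase s hs h2
    have h1 := C.left_lt g
    have h2 := C.right_lt g
    have h3 := g.isLt
    exact ⟨_, _, hmem _ (by omega), hmem _ (by omega), C.vset_nonempty hcf _ (by omega),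
      C.vset_nonempty hcf _ (by omega), C.vset_disj hcf g, C.vset_union hcf g⟩) (by
    intro i hi
    convert hmem _ (ho ⟨i, hi⟩) using 1
    ext x
    rw [LinCircuit.mem_vset]
    constructor
    · intro h
      have hb := srow_bd _ _ _ _ h
      refine ⟨by omega, ?_⟩
      rw [hv, srow_iff k 0]
      simpa using h
    · rintro ⟨h, h1⟩
      rw [hv, srow_iff k 0] at h1
      simpa using h1)
  have hle : (F.filter (fun s => 2 ≤ s.card)).card ≤ C.gates := by
    have : F.filter (fun s => 2 ≤ s.card) ⊆
        (Finset.univ : Finset (Fin C.gates)).image (fun g => C.vset (2 ^ k + g.val)) := by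
      intro s hs
      obtain ⟨h1, h2⟩ := Finset.mem_filter.1 hs
      obtain ⟨g, hg⟩ := hcase s h1 h2
      exact Finset.mem_image.2 ⟨g, Finset.mem_univ _, hg⟩
    refine (Finset.card_le_card this).trans (Finset.card_image_le.trans ?_)
    simp
  obtain ⟨k, rfl⟩ : ∃ k', k = k' + 1 := ⟨k - 1, by omega⟩
  rw [Nat.add_sub_cancel]
  rw [pow_succ] at hmain
  have : (k + 1) * (2 ^ k * 2) = 2 * ((k + 1) * 2 ^ k) := by ring
  omega
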